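/- arXiv:1301.4869 — 2 statements merged into one kernel-verified Lean document; each statement's English description precedes it below -/
import Mathlib

section
/- Let 0 ≤ t < T, σ > 0, x > 0, K > 0, and let X and Y be independent real random variables with Y Gaussian of mean 0 and variance T − t, and with exp(σX) integrable. Then, almost surely, E[max(x·exp(−σ²T/2 + σ(X + Y)) − K, 0) | σ(X)] = G^B(x·exp(−σ²t/2 + σX), σ, K, T − t). -/
open MeasureTheory ProbabilityTheory Real

/-- The standard normal distribution function Φ. -/
noncomputable def stdNormalCDF (y : ℝ) : ℝ :=
  ∫ z in Set.Iic y, (Real.sqrt (2 * Real.pi))⁻¹ * Real.exp (-z ^ 2 / 2)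

/-- Black's formula G^B(x, σ, K, T) = xΦ(d₁) − KΦ(d₂) for the forward price
of a European call option. -/
noncomputable def blackFormula (x σ K T : ℝ) : ℝ :=
  x * stdNormalCDF (Real.log (x / K) / (σ * Real.sqrt T) + σ * Real.sqrt T / 2)
    - K * stdNormalCDF (Real.log (x / K) / (σ * Real.sqrt T) + σ * Real.sqrt T / 2
        - σ * Real.sqrt T)

/-- The standard normal distribution function as an integral of Mathlib's Gaussian density. -/
lemma stdNormalCDF_eq_setIntegral_gaussianPDFReal (y : ℝ) :
    stdNormalCDF y = ∫ z in Set.Iic y, gaussianPDFReal 0 1 z := by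
  simp [stdNormalCDF, gaussianPDFReal_def]

/-- Completing the square in the Gaussian density. -/
lemma gaussianPDFReal_zero_one_mul_exp (s z : ℝ) :
    gaussianPDFReal 0 1 z * exp (-s ^ 2 / 2 - s * z) = gaussianPDFReal 0 1 (z + s) := by
  simp only [gaussianPDFReal_def, mul_assoc, ← exp_add]
  congr 2
  push_cast
  ring

/-- Translation of a half-line integral of the Gaussian density. -/
lemma setIntegral_Iic_gaussianPDFReal_add (s d : ℝ) :
    ∫ z in Set.Iic (d - s), gaussianPDFReal 0 1 (z + s) = stdNormalCDF d := by
  rw [stdNormalCDF_eq_setIntegral_gaussianPDFReal, ← integral_indicator measurableSet_Iic,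
    ← integral_indicator measurableSet_Iic,
    ← integral_add_right_eq_self (Set.indicator (Set.Iic d) _) s]
  congr 1 with z
  simp [Set.indicator_apply, le_sub_iff_add_le]

/-- The call payoff is the exercised payoff on the half-line where it is nonnegative. -/
lemma max_call_payoff_eq_indicator {y s K : ℝ} (hy : 0 < y) (hs : 0 < s) (hK : 0 < K) (z : ℝ) :
    max (y * exp (-s ^ 2 / 2 - s * z) - K) 0 =
      (Set.Iic (log (y / K) / s + s / 2 - s)).indicator
        (fun z => y * exp (-s ^ 2 / 2 - s * z) - K) z := by
  have hiff : z ≤ log (y / K) / s + s / 2 - s ↔ K ≤ y * exp (-s ^ 2 / 2 - s * z) := by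
    rw [← log_le_log_iff hK (by positivity), log_mul hy.ne' (exp_pos _).ne', log_exp,
      log_div hy.ne' hK.ne', ← mul_le_mul_iff_right₀ hs]
    have : s * ((log y - log K) / s + s / 2 - s) = log y - log K - s ^ 2 / 2 := by
      field_simp
      ring
    rw [this]
    constructor <;> intro h <;> linarith
  rw [Set.indicator_apply]
  split_ifs with h
  · exact max_eq_left (sub_nonneg.2 (hiff.1 h))
  · exact max_eq_right (sub_nonpos.2 (not_le.1 (fun h' => h (hiff.2 h'))).le)

/-- The expected call payoff on a lognormal forward with total volatility `s`. -/
lemma integral_call_payoff_gaussianReal_zero_one {y s K : ℝ} (hy : 0 < y) (hs : 0 < s)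
    (hK : 0 < K) :
    ∫ z, max (y * exp (-s ^ 2 / 2 - s * z) - K) 0 ∂gaussianReal 0 1 =
      y * stdNormalCDF (log (y / K) / s + s / 2)
        - K * stdNormalCDF (log (y / K) / s + s / 2 - s) := by
  set d := log (y / K) / s + s / 2
  have hdensity (z : ℝ) :
      gaussianPDFReal 0 1 z • max (y * exp (-s ^ 2 / 2 - s * z) - K) 0 =
        (Set.Iic (d - s)).indicator
          (fun z => y * gaussianPDFReal 0 1 (z + s) - K * gaussianPDFReal 0 1 z) z := by
    rw [max_call_payoff_eq_indicator hy hs hK, ← Set.indicator_smul_apply]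
    congr 1 with z
    rw [← gaussianPDFReal_zero_one_mul_exp, smul_eq_mul]
    ring
  rw [integral_gaussianReal_eq_integral_smul one_ne_zero]
  simp_rw [hdensity]
  rw [integral_indicator measurableSet_Iic,
    integral_sub (((integrable_gaussianPDFReal 0 1).comp_add_right s).const_mul y).integrableOn
      ((integrable_gaussianPDFReal 0 1).const_mul K).integrableOn,
    integral_const_mul, integral_const_mul, setIntegral_Iic_gaussianPDFReal_add,
    ← stdNormalCDF_eq_setIntegral_gaussianPDFReal]

/-- Black's formula is the expected call payoff on a lognormal forward. -/
lemma integral_call_payoff_gaussianReal {y σ K : ℝ} {τ : NNReal} (hy : 0 < y) (hσ : 0 < σ)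
    (hK : 0 < K) (hτ : 0 < τ) :
    ∫ z, max (y * exp (-σ ^ 2 * τ / 2 + σ * z) - K) 0 ∂gaussianReal 0 τ =
      blackFormula y σ K τ := by
  have hmap : gaussianReal 0 τ = (gaussianReal 0 1).map (-√(τ : ℝ) * ·) := by
    rw [gaussianReal_map_const_mul]
    congr 1
    · simp
    · ext
      simp
  have hsq : (σ * √(τ : ℝ)) ^ 2 = σ ^ 2 * τ := by
    rw [mul_pow, sq_sqrt τ.coe_nonneg]
  rw [hmap, integral_map (by fun_prop) (Continuous.aestronglyMeasurable (by fun_prop)),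
    blackFormula, ← integral_call_payoff_gaussianReal_zero_one hy
      (mul_pos hσ (sqrt_pos.2 (NNReal.coe_pos.2 hτ))) hK]
  congr 1 with z
  rw [hsq]
  ring_nf

/-- Conditional expectation of a function of independent variables: freeze the first variable and
integrate over the law of the second. -/
lemma condExp_prod_ae_eq_integral_map_of_indepFun {Ω : Type*} [MeasurableSpace Ω] {P : Measure Ω}
    [IsFiniteMeasure P] {X Y : Ω → ℝ} (hX : Measurable X) (hY : Measurable Y)
    (hXY : IndepFun X Y P) {f : ℝ × ℝ → ℝ} (hf : StronglyMeasurable f)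
    (hint : Integrable (fun ω => f (X ω, Y ω)) P) :
    P[fun ω => f (X ω, Y ω) | MeasurableSpace.comap X inferInstance]
      =ᵐ[P] fun ω => ∫ y, f (X ω, y) ∂P.map Y := by
  have hkernel : condDistrib Y X P =ᵐ[P.map X] Kernel.const ℝ (P.map Y) := by
    apply condDistrib_ae_eq_of_measure_eq_compProd X hY.aemeasurable
    rw [Measure.compProd_const,
      (indepFun_iff_map_prod_eq_prod_map_map hX.aemeasurable hY.aemeasurable).1 hXY]
  filter_upwards [condExp_prod_ae_eq_integral_condDistrib hX hY.aemeasurable hf hint,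
    ae_of_ae_map hX.aemeasurable hkernel] with ω hω hω'
  rw [hω, hω', Kernel.const_apply]

/-- The conditional expected call payoff given the information at time t
equals Black's formula with forward x·exp(−σ²t/2 + σX) and maturity T − t. -/
theorem condexp_call_payoff_black_formula
    {Ω : Type*} [MeasurableSpace Ω] (P : Measure Ω) [IsProbabilityMeasure P]
    (t T σ x K : ℝ) (ht : 0 ≤ t) (htT : t < T) (hσ : 0 < σ) (hx : 0 < x) (hK : 0 < K)
    (X Y : Ω → ℝ) (hXm : Measurable X) (hYm : Measurable Y)
    (hindep : IndepFun X Y P)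
    (hY : Measure.map Y P = gaussianReal 0 ⟨T - t, by linarith⟩)
    (hint : Integrable (fun ω => Real.exp (σ * X ω)) P) :
    P[fun ω => max (x * Real.exp (-σ ^ 2 * T / 2 + σ * (X ω + Y ω)) - K) 0 |
        MeasurableSpace.comap X inferInstance]
      =ᵐ[P] fun ω =>
        blackFormula (x * Real.exp (-σ ^ 2 * t / 2 + σ * X ω)) σ K (T - t) := by
  have hpay : StronglyMeasurable
      fun p : ℝ × ℝ => max (x * exp (-σ ^ 2 * T / 2 + σ * (p.1 + p.2)) - K) 0 :=
    Continuous.stronglyMeasurable (by fun_prop)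
  have hexpY : Integrable (fun ω => exp (σ * Y ω)) P := by
    have h := integrable_exp_mul_gaussianReal (μ := 0) (v := ⟨T - t, by linarith⟩) σ
    rw [← hY] at h
    exact h.comp_measurable hYm
  have hexp : Integrable (fun ω => exp (σ * X ω) * exp (σ * Y ω)) P :=
    (hindep.comp (φ := fun z => exp (σ * z)) (ψ := fun z => exp (σ * z))
      (by fun_prop) (by fun_prop)).integrable_mul hint hexpY
  have hpayInt : Integrable
      (fun ω => max (x * exp (-σ ^ 2 * T / 2 + σ * (X ω + Y ω)) - K) 0) P := by
    refine (((hexp.const_mul (x * exp (-σ ^ 2 * T / 2))).sub (integrable_const K)).pos_part).congr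
      (ae_of_all _ fun ω => ?_)
    simp only [Pi.sub_apply, mul_add, exp_add, mul_assoc]
  filter_upwards [condExp_prod_ae_eq_integral_map_of_indepFun hXm hYm hindep hpay hpayInt]
    with ω hω
  obtain ⟨τ, hτ, hYτ⟩ : ∃ τ : NNReal, (τ : ℝ) = T - t ∧ P.map Y = gaussianReal 0 τ :=
    ⟨_, rfl, hY⟩
  have hblack := integral_call_payoff_gaussianReal (τ := τ)
    (y := x * exp (-σ ^ 2 * t / 2 + σ * X ω)) (by positivity) hσ hK
    (NNReal.coe_pos.1 (hτ ▸ sub_pos.2 htT))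
  rw [hτ] at hblack
  rw [hω, hYτ, ← hblack]
  congr 1 with z
  rw [mul_assoc x, ← exp_add]
  ring_nf
end

section
/- Let n ≥ 1, T > 0, m ≥ 1, let D_1, …, D_m ⊆ ℝⁿ be Borel sets, and let x_1, …, x_m > 0 and σ_1, …, σ_m > 0. Define h : [0,T) × ℝⁿ × ℝ → ℝ by h(t, w, b) = Σ_{k=1}^m u_k(t, w)·x_k·exp(−σ_k²t/2 + σ_k b), where u_k(t, w) = ∫_{D_k} (2π(T − t))^{−n/2} exp(−‖x − w‖²/(2(T − t))) dx. Then h is smooth on [0,T) × ℝⁿ × ℝ and satisfies 2·∂h/∂t + Σ_{i=1}^n ∂²h/∂w_i² + ∂²h/∂b² = 0 everywhere on [0,T) × ℝⁿ × ℝ. -/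
open MeasureTheory Real

/-- The linear functional `(a, c) ↦ -a * ∑ i, y i ^ 2 + ∑ i, y i * c i`, that is, the exponent of a
Gaussian density at `y` in terms of its natural parameters. -/
noncomputable def gaussianExponent {n : ℕ} (y : Fin n → ℝ) : ℝ × (Fin n → ℝ) →L[ℝ] ℝ :=
  (-∑ i, y i ^ 2) • ContinuousLinearMap.fst ℝ ℝ (Fin n → ℝ)
    + ∑ i, y i • (ContinuousLinearMap.proj i).comp (ContinuousLinearMap.snd ℝ ℝ (Fin n → ℝ))

lemma gaussianExponent_apply {n : ℕ} (y : Fin n → ℝ) (e : ℝ × (Fin n → ℝ)) :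
    gaussianExponent y e = -(∑ i, y i ^ 2) * e.1 + ∑ i, y i * e.2 i := by
  simp [gaussianExponent]

lemma continuous_gaussianExponent {n : ℕ} :
    Continuous (gaussianExponent : (Fin n → ℝ) → ℝ × (Fin n → ℝ) →L[ℝ] ℝ) := by
  unfold gaussianExponent
  fun_prop

lemma norm_gaussianExponent_le {n : ℕ} (y : Fin n → ℝ) :
    ‖gaussianExponent y‖ ≤ 2 * ∑ i, y i ^ 2 + n := by
  refine ContinuousLinearMap.opNorm_le_bound _ (by positivity) fun e => ?_
  rw [gaussianExponent_apply]
  have h1 : ‖e.1‖ ≤ ‖e‖ := norm_fst_le e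
  have h2 : ∀ i, ‖e.2 i‖ ≤ ‖e‖ := fun i => (norm_le_pi_norm _ i).trans (norm_snd_le e)
  have h3 : ‖∑ i, y i * e.2 i‖ ≤ ∑ i, (y i ^ 2 + 1) * ‖e‖ := by
    refine norm_sum_le_of_le _ fun i _ => ?_
    rw [norm_mul]
    refine mul_le_mul ?_ (h2 i) (norm_nonneg _) (by positivity)
    rw [Real.norm_eq_abs]
    nlinarith [sq_nonneg (|y i| - 1), sq_abs (y i)]
  have h4 : ‖-(∑ i, y i ^ 2) * e.1‖ ≤ (∑ i, y i ^ 2) * ‖e‖ := by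
    rw [norm_mul, norm_neg, Real.norm_of_nonneg (by positivity)]
    gcongr
  rw [← Finset.sum_mul, Finset.sum_add_distrib] at h3
  simp only [Finset.sum_const, Finset.card_univ, Fintype.card_fin, nsmul_eq_mul, mul_one] at h3
  calc _ ≤ _ := norm_add_le _ _
    _ ≤ _ := add_le_add h4 h3
    _ = _ := by ring

/-- Continuous functions growing more slowly than every Gaussian `exp (δ * ∑ i, y i ^ 2)`. -/
structure SubgaussianGrowth {n : ℕ} {V : Type*} [NormedAddCommGroup V] (g : (Fin n → ℝ) → V) :
    Prop where
  continuous : Continuous g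
  bound : ∀ δ : ℝ, 0 < δ → ∃ C : ℝ, 0 ≤ C ∧ ∀ y, ‖g y‖ ≤ C * exp (δ * ∑ i, y i ^ 2)

lemma SubgaussianGrowth.const {n : ℕ} {V : Type*} [NormedAddCommGroup V] (v : V) :
    SubgaussianGrowth (fun _ : Fin n → ℝ => v) where
  continuous := continuous_const
  bound δ hδ := ⟨‖v‖, norm_nonneg _, fun y =>
    le_mul_of_one_le_right (norm_nonneg _) (one_le_exp (by positivity))⟩

lemma subgaussianGrowth_gaussianExponent {n : ℕ} :
    SubgaussianGrowth (gaussianExponent (n := n)) where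
  continuous := continuous_gaussianExponent
  bound δ hδ := by
    refine ⟨2 / δ + n, by positivity, fun y => (norm_gaussianExponent_le y).trans ?_⟩
    set N := ∑ i, y i ^ 2 with hN
    have hN0 : 0 ≤ N := by positivity
    have h1 : 1 ≤ exp (δ * N) := one_le_exp (by positivity)
    have h2 : 2 * N ≤ 2 / δ * exp (δ * N) := by
      rw [div_mul_eq_mul_div, le_div_iff₀ hδ]
      nlinarith [add_one_le_exp (δ * N)]
    nlinarith [mul_le_mul_of_nonneg_left h1 n.cast_nonneg (α := ℝ)]

lemma SubgaussianGrowth.of_norm_le_mul {n : ℕ} {U V W : Type*} [NormedAddCommGroup U]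
    [NormedAddCommGroup V] [NormedAddCommGroup W] {f : (Fin n → ℝ) → U} {g : (Fin n → ℝ) → V}
    {F : (Fin n → ℝ) → W} (hf : SubgaussianGrowth f) (hg : SubgaussianGrowth g)
    (hF : Continuous F) (hle : ∀ y, ‖F y‖ ≤ ‖f y‖ * ‖g y‖) : SubgaussianGrowth F where
  continuous := hF
  bound δ hδ := by
    obtain ⟨C, hC, hfC⟩ := hf.bound (δ / 2) (by positivity)
    obtain ⟨C', hC', hgC⟩ := hg.bound (δ / 2) (by positivity)
    refine ⟨C * C', by positivity, fun y => (hle y).trans ?_⟩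
    calc _ ≤ _ := mul_le_mul (hfC y) (hgC y) (norm_nonneg _) (by positivity)
      _ = C * C' * (exp (δ / 2 * ∑ i, y i ^ 2) * exp (δ / 2 * ∑ i, y i ^ 2)) := by ring
      _ = _ := by rw [← exp_add]; ring_nf

section Growth

variable {n : ℕ} {V : Type*} [NormedAddCommGroup V] [NormedSpace ℝ V]

lemma SubgaussianGrowth.gaussianExponent_smulRight {g : (Fin n → ℝ) → V}
    (hg : SubgaussianGrowth g) :
    SubgaussianGrowth (fun y => (gaussianExponent y).smulRight (g y)) := by
  refine subgaussianGrowth_gaussianExponent.of_norm_le_mul hg ?_ fun y => ?_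
  · exact ((ContinuousLinearMap.smulRightL ℝ (ℝ × (Fin n → ℝ)) V).continuous.comp
      continuous_gaussianExponent).clm_apply hg.continuous
  · rw [ContinuousLinearMap.norm_smulRight_apply]

lemma SubgaussianGrowth.gaussianExponent_mul {g : (Fin n → ℝ) → ℝ}
    (hg : SubgaussianGrowth g) (v : ℝ × (Fin n → ℝ)) :
    SubgaussianGrowth (fun y => gaussianExponent y v * g y) := by
  have h := subgaussianGrowth_gaussianExponent.of_norm_le_mul (SubgaussianGrowth.const (n := n) v)
    (continuous_gaussianExponent.clm_apply continuous_const)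
    fun y => (gaussianExponent y).le_opNorm v
  exact h.of_norm_le_mul hg (h.continuous.mul hg.continuous) fun y => (norm_mul _ _).le

lemma integrable_exp_neg_mul_sum_sq {a : ℝ} (ha : 0 < a) :
    Integrable (fun y : Fin n → ℝ => exp (-a * ∑ i, y i ^ 2)) := by
  have h := Integrable.fintype_prod (ι := Fin n) (fun _ => integrable_exp_neg_mul_sq ha)
  simpa only [volume_pi, ← exp_sum, ← Finset.mul_sum] using h

lemma SubgaussianGrowth.exists_norm_exp_smul_le {g : (Fin n → ℝ) → V}
    (hg : SubgaussianGrowth g) {a : ℝ} (ha : 0 < a) (R : ℝ) :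
    ∃ C : ℝ, ∀ y, ∀ e : ℝ × (Fin n → ℝ), a ≤ e.1 → ‖e.2‖ ≤ R →
      ‖exp (gaussianExponent y e) • g y‖ ≤ C * exp (-(a / 2) * ∑ i, y i ^ 2) := by
  obtain ⟨C, hC, hgC⟩ := hg.bound (a / 4) (by positivity)
  refine ⟨C * exp (n * (R ^ 2 / a)), fun y e he hR => ?_⟩
  have h1 : ∑ i, y i * e.2 i ≤ ∑ i, (a / 4 * y i ^ 2 + R ^ 2 / a) := by
    refine Finset.sum_le_sum fun i _ => ?_
    have hi : |e.2 i| ≤ R := (norm_le_pi_norm _ i).trans hR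
    have hi2 : e.2 i ^ 2 ≤ R ^ 2 := by
      rw [← sq_abs]; gcongr
    have : y i * e.2 i ≤ a / 4 * y i ^ 2 + e.2 i ^ 2 / a := by
      have h0 : 0 ≤ (a * y i / 2 - e.2 i) ^ 2 / a := by positivity
      have h2 : (a * y i / 2 - e.2 i) ^ 2 / a
          = a / 4 * y i ^ 2 + e.2 i ^ 2 / a - y i * e.2 i := by
        field_simp; ring
      linarith
    have h3 : e.2 i ^ 2 / a ≤ R ^ 2 / a := by gcongr
    linarith
  rw [Finset.sum_add_distrib, ← Finset.mul_sum] at h1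
  simp only [Finset.sum_const, Finset.card_univ, Fintype.card_fin, nsmul_eq_mul] at h1
  have h2 : gaussianExponent y e ≤ -(3 * a / 4) * ∑ i, y i ^ 2 + n * (R ^ 2 / a) := by
    rw [gaussianExponent_apply]
    have hN0 : 0 ≤ ∑ i, y i ^ 2 := by positivity
    nlinarith [mul_le_mul_of_nonneg_left he hN0]
  rw [norm_smul, Real.norm_of_nonneg (exp_pos _).le]
  calc _ ≤ exp (-(3 * a / 4) * ∑ i, y i ^ 2 + n * (R ^ 2 / a))
        * (C * exp (a / 4 * ∑ i, y i ^ 2)) :=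
        mul_le_mul (exp_le_exp.2 h2) (hgC y) (norm_nonneg _) (exp_pos _).le
    _ = C * exp (n * (R ^ 2 / a))
        * (exp (-(3 * a / 4) * ∑ i, y i ^ 2) * exp (a / 4 * ∑ i, y i ^ 2)) := by
        rw [exp_add]; ring
    _ = _ := by rw [← exp_add]; ring_nf

lemma SubgaussianGrowth.aestronglyMeasurable_exp_smul {g : (Fin n → ℝ) → V}
    (hg : SubgaussianGrowth g) (e : ℝ × (Fin n → ℝ)) (μ : Measure (Fin n → ℝ)) :
    AEStronglyMeasurable (fun y => exp (gaussianExponent y e) • g y) μ :=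
  ((continuous_exp.comp (continuous_gaussianExponent.clm_apply continuous_const)).smul
    hg.continuous).aestronglyMeasurable

lemma SubgaussianGrowth.integrable_exp_smul {g : (Fin n → ℝ) → V}
    (hg : SubgaussianGrowth g) {e : ℝ × (Fin n → ℝ)} (he : 0 < e.1) (D : Set (Fin n → ℝ)) :
    Integrable (fun y => exp (gaussianExponent y e) • g y) (volume.restrict D) := by
  obtain ⟨C, hC⟩ := hg.exists_norm_exp_smul_le he ‖e.2‖
  exact ((integrable_exp_neg_mul_sum_sq (half_pos he)).const_mul C).restrict.mono'
    (hg.aestronglyMeasurable_exp_smul e _) (.of_forall fun y => hC y e le_rfl le_rfl)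

lemma SubgaussianGrowth.hasFDerivAt_integral {g : (Fin n → ℝ) → V}
    (hg : SubgaussianGrowth g) {e : ℝ × (Fin n → ℝ)} (he : 0 < e.1) (D : Set (Fin n → ℝ)) :
    HasFDerivAt (fun e => ∫ y in D, exp (gaussianExponent y e) • g y)
      (∫ y in D, exp (gaussianExponent y e) • (gaussianExponent y).smulRight (g y)) e := by
  obtain ⟨C, hC⟩ := hg.gaussianExponent_smulRight.exists_norm_exp_smul_le (half_pos he) (‖e.2‖ + 1)
  have hs : {e' : ℝ × (Fin n → ℝ) | e.1 / 2 < e'.1 ∧ ‖e'.2‖ < ‖e.2‖ + 1} ∈ nhds e := by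
    refine IsOpen.mem_nhds ?_ ⟨half_lt_self he, lt_add_one _⟩
    exact (isOpen_lt continuous_const continuous_fst).inter
      (isOpen_lt continuous_snd.norm continuous_const)
  refine hasFDerivAt_integral_of_dominated_of_fderiv_le (μ := volume.restrict D)
    (F := fun e y => exp (gaussianExponent y e) • g y)
    (F' := fun e y => exp (gaussianExponent y e) • (gaussianExponent y).smulRight (g y))
    hs (.of_forall fun e' => hg.aestronglyMeasurable_exp_smul e' _)
    (hg.integrable_exp_smul he D)
    (hg.gaussianExponent_smulRight.aestronglyMeasurable_exp_smul e _)
    (.of_forall fun y e' he' => hC y e' he'.1.le he'.2.le)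
    ((integrable_exp_neg_mul_sum_sq (half_pos (half_pos he))).const_mul C).restrict
    (.of_forall fun y e' _ => ?_)
  convert (gaussianExponent y).hasFDerivAt.exp.smul_const (g y) using 1
  ext v <;> simp [smul_smul]

end Growth

lemma SubgaussianGrowth.contDiffOn_integral_nat {n : ℕ} (D : Set (Fin n → ℝ)) (k : ℕ)
    {V : Type} [NormedAddCommGroup V] [NormedSpace ℝ V] {g : (Fin n → ℝ) → V}
    (hg : SubgaussianGrowth g) :
    ContDiffOn ℝ k (fun e => ∫ y in D, exp (gaussianExponent y e) • g y)
      {e : ℝ × (Fin n → ℝ) | 0 < e.1} := by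
  induction k generalizing V with
  | zero =>
    rw [Nat.cast_zero, contDiffOn_zero]
    exact fun e he => (hg.hasFDerivAt_integral he D).continuousAt.continuousWithinAt
  | succ k ih =>
    have ho : IsOpen {e : ℝ × (Fin n → ℝ) | 0 < e.1} := isOpen_lt continuous_const continuous_fst
    rw [Nat.cast_succ, contDiffOn_succ_iff_hasFDerivWithinAt_of_uniqueDiffOn ho.uniqueDiffOn]
    exact ⟨by simp, _, ih hg.gaussianExponent_smulRight,
      fun e he => (hg.hasFDerivAt_integral he D).hasFDerivWithinAt⟩

lemma SubgaussianGrowth.hasDerivAt_integral {n : ℕ} {g : (Fin n → ℝ) → ℝ}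
    (hg : SubgaussianGrowth g) (D : Set (Fin n → ℝ)) {γ : ℝ → ℝ × (Fin n → ℝ)}
    {γ' : ℝ × (Fin n → ℝ)} {s : ℝ} (hγ : HasDerivAt γ γ' s) (hs : 0 < (γ s).1) :
    HasDerivAt (fun s => ∫ y in D, exp (gaussianExponent y (γ s)) * g y)
      (∫ y in D, exp (gaussianExponent y (γ s)) * (gaussianExponent y γ' * g y)) s := by
  have h := (hg.hasFDerivAt_integral hs D).comp_hasDerivAt s hγ
  rw [ContinuousLinearMap.integral_apply
    (hg.gaussianExponent_smulRight.integrable_exp_smul hs D)] at h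
  simpa [Function.comp_def] using h

/-- The probability that a Gaussian vector with mean `w` and covariance `(T - t) • 1` lies in `D`. -/
noncomputable def gaussianMass {n : ℕ} (T : ℝ) (D : Set (Fin n → ℝ)) (t : ℝ) (w : Fin n → ℝ) : ℝ :=
  ∫ y in D, (2 * π * (T - t)) ^ (-(n : ℝ) / 2) * exp (-(∑ i, (y i - w i) ^ 2) / (2 * (T - t)))

/-- The part of the Gaussian density with mean `w` and covariance `(T - t) • 1` that does not depend
on the point of evaluation. -/
noncomputable def gaussianPrefactor {n : ℕ} (T t : ℝ) (w : Fin n → ℝ) : ℝ :=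
  (2 * π * (T - t)) ^ (-(n : ℝ) / 2) * exp (-(∑ i, w i ^ 2) / (2 * (T - t)))

/-- The natural parameters of the Gaussian density with mean `w` and covariance `(T - t) • 1`. -/
noncomputable def gaussianParam {n : ℕ} (T t : ℝ) (w : Fin n → ℝ) : ℝ × (Fin n → ℝ) :=
  ((2 * (T - t))⁻¹, (T - t)⁻¹ • w)

lemma gaussianMass_eq {n : ℕ} (T : ℝ) (D : Set (Fin n → ℝ)) (t : ℝ) (w : Fin n → ℝ) :
    gaussianMass T D t w = gaussianPrefactor T t w
      * ∫ y in D, exp (gaussianExponent y (gaussianParam T t w)) * (1 : ℝ) := by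
  rw [gaussianMass, ← integral_const_mul]
  congr 1
  funext y
  rw [gaussianPrefactor, mul_one, mul_assoc ((2 * π * (T - t)) ^ _), ← exp_add, gaussianExponent_apply]
  congr 2
  have h : ∑ i, (y i - w i) ^ 2 = ∑ i, y i ^ 2 - 2 * ∑ i, y i * w i + ∑ i, w i ^ 2 := by
    rw [Finset.mul_sum, ← Finset.sum_sub_distrib, ← Finset.sum_add_distrib]
    exact Finset.sum_congr rfl fun i _ => by ring
  have h' : ∑ i, y i * (gaussianParam T t w).2 i = (T - t)⁻¹ * ∑ i, y i * w i := by
    rw [Finset.mul_sum]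
    exact Finset.sum_congr rfl fun i _ => by simp [gaussianParam]; ring
  rw [h, h', gaussianParam, div_eq_mul_inv, div_eq_mul_inv, mul_inv]
  ring

lemma gaussianParam_fst_pos {n : ℕ} {T t : ℝ} (ht : t < T) (w : Fin n → ℝ) :
    0 < (gaussianParam T t w).1 := by
  have : 0 < T - t := sub_pos.2 ht
  simp only [gaussianParam]
  positivity

lemma contDiffOn_gaussianMass {n : ℕ} (T : ℝ) (D : Set (Fin n → ℝ)) :
    ContDiffOn ℝ (⊤ : ℕ∞) (fun p : ℝ × (Fin n → ℝ) => gaussianMass T D p.1 p.2)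
      {p | p.1 < T} := by
  simp only [gaussianMass_eq]
  have hne : ∀ p ∈ {p : ℝ × (Fin n → ℝ) | p.1 < T}, T - p.1 ≠ 0 := fun p hp => (sub_pos.2 hp).ne'
  have hsub : ContDiffOn ℝ (⊤ : ℕ∞) (fun p : ℝ × (Fin n → ℝ) => T - p.1) {p | p.1 < T} := by
    fun_prop
  have hM : ContDiffOn ℝ (⊤ : ℕ∞) (fun e => ∫ y in D, exp (gaussianExponent y e) * (1 : ℝ))
      {e : ℝ × (Fin n → ℝ) | 0 < e.1} :=
    contDiffOn_infty.2 fun k => (SubgaussianGrowth.const (1 : ℝ)).contDiffOn_integral_nat D k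
  refine ContDiffOn.mul ?_ (hM.comp (f := fun p : ℝ × (Fin n → ℝ) => gaussianParam T p.1 p.2) ?_
    fun p hp => gaussianParam_fst_pos hp p.2)
  · refine ContDiffOn.mul ?_ (ContDiffOn.exp (ContDiffOn.div ?_ (contDiffOn_const.mul hsub) ?_))
    · exact (contDiffOn_const.mul hsub).rpow_const_of_ne fun p hp =>
        mul_ne_zero (by positivity) (hne p hp)
    · fun_prop
    · exact fun p hp => mul_ne_zero two_ne_zero (hne p hp)
  · exact ((contDiffOn_const.mul hsub).inv fun p hp => mul_ne_zero two_ne_zero (hne p hp)).prodMk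
      ((hsub.inv hne).smul contDiffOn_snd)

lemma hasDerivAt_gaussianPrefactor_time {n : ℕ} {T t : ℝ} (ht : t < T) (w : Fin n → ℝ) :
    HasDerivAt (fun t => gaussianPrefactor T t w)
      (gaussianPrefactor T t w * (n / (2 * (T - t)) - (∑ i, w i ^ 2) / (2 * (T - t) ^ 2))) t := by
  have hτ : 0 < T - t := sub_pos.2 ht
  have hb : 2 * π * (T - t) ≠ 0 := by positivity
  have hd : HasDerivAt (fun t => T - t) (-1) t := by simpa using (hasDerivAt_id t).const_sub T
  have h1 := (hd.const_mul (2 * π)).rpow_const (p := -(n : ℝ) / 2) (Or.inl hb)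
  have h2 := ((hasDerivAt_const t (-∑ i, w i ^ 2)).div (hd.const_mul 2) (by positivity)).exp
  refine (h1.mul h2).congr_deriv ?_
  rw [rpow_sub_one hb, gaussianPrefactor]
  simp only [Pi.div_apply]
  field_simp
  ring

lemma hasDerivAt_gaussianPrefactor_update {n : ℕ} (T t : ℝ) (w : Fin n → ℝ) (i : Fin n) (s : ℝ) :
    HasDerivAt (fun s => gaussianPrefactor T t (Function.update w i s))
      (gaussianPrefactor T t (Function.update w i s) * (-s / (T - t))) s := by
  have h1 : HasDerivAt (fun s => ∑ j, Function.update w i s j ^ 2) (2 * s) s := by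
    have h := HasDerivAt.fun_sum (u := Finset.univ) fun j _ =>
      (hasDerivAt_pi.1 (hasDerivAt_update w i s) j).pow 2
    refine h.congr_deriv ?_
    simp [Pi.single_apply]
  refine ((h1.neg.div_const (2 * (T - t))).exp.const_mul _).congr_deriv ?_
  rw [gaussianPrefactor, ← mul_neg, mul_div_mul_left _ _ two_ne_zero, ← mul_assoc]
  simp only [Pi.neg_apply]

lemma hasDerivAt_gaussianParam_time {n : ℕ} {T t : ℝ} (ht : t < T) (w : Fin n → ℝ) :
    HasDerivAt (fun t => gaussianParam T t w) ((2 * (T - t) ^ 2)⁻¹, ((T - t) ^ 2)⁻¹ • w) t := by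
  have hτ : T - t ≠ 0 := (sub_pos.2 ht).ne'
  have hd : HasDerivAt (fun t => T - t) (-1) t := by simpa using (hasDerivAt_id t).const_sub T
  refine HasDerivAt.prodMk (((hd.const_mul 2).inv (by positivity)).congr_deriv ?_)
    (((hd.inv hτ).congr_deriv ?_).smul_const w)
  · field_simp
  · field_simp

lemma hasDerivAt_gaussianParam_update {n : ℕ} (T t : ℝ) (w : Fin n → ℝ) (i : Fin n) (s : ℝ) :
    HasDerivAt (fun s => gaussianParam T t (Function.update w i s))
      (0, (T - t)⁻¹ • Pi.single i 1) s :=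
  (hasDerivAt_const s _).prodMk ((hasDerivAt_update w i s).const_smul (T - t)⁻¹)

/-- The Gaussian mass of a set solves the backward heat equation. -/
lemma exists_hasDerivAt_gaussianMass {n : ℕ} {T t : ℝ} (ht : t < T) (D : Set (Fin n → ℝ))
    (w : Fin n → ℝ) :
    ∃ (d : ℝ) (d₁ : Fin n → ℝ → ℝ) (d₂ : Fin n → ℝ),
      HasDerivAt (fun t => gaussianMass T D t w) d t ∧
      (∀ i s, HasDerivAt (fun s => gaussianMass T D t (Function.update w i s)) (d₁ i s) s) ∧
      (∀ i, HasDerivAt (d₁ i) (d₂ i) (w i)) ∧ 2 * d + ∑ i, d₂ i = 0 := by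
  have hτ : 0 < T - t := sub_pos.2 ht
  simp only [gaussianMass_eq]
  have hg : SubgaussianGrowth (fun _ : Fin n → ℝ => (1 : ℝ)) := .const 1
  let v (i : Fin n) : ℝ × (Fin n → ℝ) := (0, (T - t)⁻¹ • Pi.single i 1)
  have hgi (i : Fin n) := hg.gaussianExponent_mul (v i)
  have hgii (i : Fin n) := (hgi i).gaussianExponent_mul (v i)
  have hv (y : Fin n → ℝ) (i : Fin n) : gaussianExponent y (v i) = y i / (T - t) := by
    simp [gaussianExponent_apply, v, Pi.single_apply, div_eq_mul_inv]
  have hM (i : Fin n) (s : ℝ) := hg.hasDerivAt_integral D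
    (hasDerivAt_gaussianParam_update T t w i s) (gaussianParam_fst_pos ht _)
  have hMi (i : Fin n) (s : ℝ) := (hgi i).hasDerivAt_integral D
    (hasDerivAt_gaussianParam_update T t w i s) (gaussianParam_fst_pos ht _)
  have hP (i : Fin n) (s : ℝ) := hasDerivAt_gaussianPrefactor_update T t w i s
  have hsplit : ∫ y in D, exp (gaussianExponent y (gaussianParam T t w)) *
        (gaussianExponent y ((2 * (T - t) ^ 2)⁻¹, ((T - t) ^ 2)⁻¹ • w) * 1)
      = ∑ i, (w i / (T - t) * (∫ y in D, exp (gaussianExponent y (gaussianParam T t w)) *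
            (gaussianExponent y (v i) * 1))
          - 1 / 2 * ∫ y in D, exp (gaussianExponent y (gaussianParam T t w)) *
            (gaussianExponent y (v i) * (gaussianExponent y (v i) * 1))) := by
    have h1 (i : Fin n) := (((hgi i).integrable_exp_smul
      (gaussianParam_fst_pos ht w) D).const_mul (w i / (T - t)))
    have h2 (i : Fin n) := (((hgii i).integrable_exp_smul
      (gaussianParam_fst_pos ht w) D).const_mul (1 / 2))
    simp only [smul_eq_mul] at h1 h2
    simp_rw [← integral_const_mul, ← integral_sub (h1 _) (h2 _)]
    rw [← integral_finsetSum _ fun i _ => (h1 i).sub' (h2 i)]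
    congr 1
    funext y
    rw [gaussianExponent_apply _ (_, ((T - t) ^ 2)⁻¹ • w)]
    simp only [hv, Pi.smul_apply, smul_eq_mul]
    rw [neg_mul, Finset.sum_mul, ← Finset.sum_neg_distrib, ← Finset.sum_add_distrib,
      Finset.sum_mul, Finset.mul_sum]
    refine Finset.sum_congr rfl fun i _ => ?_
    field_simp
    ring
  refine ⟨_, _, _, (hasDerivAt_gaussianPrefactor_time ht w).mul (hg.hasDerivAt_integral D
    (hasDerivAt_gaussianParam_time ht w) (gaussianParam_fst_pos ht w)),
    fun i s => (hP i s).mul (hM i s), fun i => (((hP i (w i)).mul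
      ((hasDerivAt_id (w i)).neg.div_const (T - t))).mul (hM i (w i))).add
      ((hP i (w i)).mul (hMi i (w i))), ?_⟩
  simp only [Function.update_eq_self, hsplit, Pi.mul_apply, Pi.neg_apply, id]
  have hn : (n : ℝ) / (2 * (T - t)) - (∑ i, w i ^ 2) / (2 * (T - t) ^ 2)
      = ∑ i, (1 / (2 * (T - t)) - w i ^ 2 / (2 * (T - t) ^ 2)) := by
    rw [Finset.sum_sub_distrib, Finset.sum_div]
    simp [div_eq_mul_inv]
  rw [hn, Finset.mul_sum, Finset.mul_sum, Finset.sum_mul, ← Finset.sum_add_distrib,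
    Finset.mul_sum, ← Finset.sum_add_distrib]
  refine Finset.sum_eq_zero fun i _ => ?_
  simp only [v]
  field_simp
  ring

lemma iteratedDeriv_two_eq {f f' : ℝ → ℝ} {f'' x : ℝ} (hf : ∀ y, HasDerivAt f (f' y) y)
    (hf' : HasDerivAt f' f'' x) : iteratedDeriv 2 f x = f'' := by
  rw [iteratedDeriv_succ, iteratedDeriv_one, show deriv f = f' from funext fun y => (hf y).deriv]
  exact hf'.deriv

/-- The model forward price h(t, w, b) = Σ_k u_k(t, w)·x_k·exp(−σ_k²t/2 + σ_k b),
with u_k the Gaussian mixture probabilities, is smooth on [0,T) × ℝⁿ × ℝ and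
satisfies 2·∂h/∂t + Σᵢ ∂²h/∂wᵢ² + ∂²h/∂b² = 0 (the martingale drift condition). -/
theorem forward_price_martingale_pde
    (n : ℕ) (hn : 1 ≤ n) (T : ℝ) (hT : 0 < T)
    (m : ℕ) (hm : 1 ≤ m)
    (D : Fin m → Set (Fin n → ℝ)) (hD : ∀ k, MeasurableSet (D k))
    (x σ : Fin m → ℝ) (hx : ∀ k, 0 < x k) (hσ : ∀ k, 0 < σ k)
    (u : Fin m → ℝ × (Fin n → ℝ) → ℝ)
    (hu : ∀ k t w, u k (t, w) = ∫ y in D k,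
      (2 * Real.pi * (T - t)) ^ (-(n : ℝ) / 2)
        * Real.exp (-(∑ i, (y i - w i) ^ 2) / (2 * (T - t))))
    (h : ℝ × (Fin n → ℝ) × ℝ → ℝ)
    (hh : ∀ t w b, h (t, w, b) =
      ∑ k, u k (t, w) * x k * Real.exp (-(σ k) ^ 2 * t / 2 + σ k * b)) :
    ContDiffOn ℝ (⊤ : ℕ∞) h (Set.Ico 0 T ×ˢ (Set.univ : Set (Fin n → ℝ)) ×ˢ (Set.univ : Set ℝ)) ∧
    ∀ t ∈ Set.Ico (0 : ℝ) T, ∀ w b,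
      2 * deriv (fun t' => h (t', w, b)) t
        + ∑ i, iteratedDeriv 2 (fun y => h (t, Function.update w i y, b)) (w i)
        + iteratedDeriv 2 (fun b' => h (t, w, b')) b = 0 := by
  have hu' (k : Fin m) (t : ℝ) (w : Fin n → ℝ) : u k (t, w) = gaussianMass T (D k) t w := hu k t w
  simp only [hu'] at hh
  refine ⟨?_, fun t ht w b => ?_⟩
  · have hh' : h = fun p => ∑ k, gaussianMass T (D k) p.1 p.2.1 * x k
        * Real.exp (-(σ k) ^ 2 * p.1 / 2 + σ k * p.2.2) := funext fun p => hh p.1 p.2.1 p.2.2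
    rw [hh']
    refine ContDiffOn.sum fun k _ => ContDiffOn.mul (ContDiffOn.mul ?_ contDiffOn_const) ?_
    · exact (contDiffOn_gaussianMass T (D k)).comp
        (f := fun p : ℝ × (Fin n → ℝ) × ℝ => (p.1, p.2.1)) (by fun_prop) fun p hp => hp.1.2
    · fun_prop
  · simp only [hh]
    choose d d₁ d₂ hd hd₁ hd₂ hsum using fun k => exists_hasDerivAt_gaussianMass ht.2 (D k) w
    have hexp_t (k : Fin m) : HasDerivAt (fun t => Real.exp (-(σ k) ^ 2 * t / 2 + σ k * b))
        (Real.exp (-(σ k) ^ 2 * t / 2 + σ k * b) * (-(σ k) ^ 2 / 2)) t := by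
      refine HasDerivAt.exp (HasDerivAt.add_const _ ?_)
      simpa using ((hasDerivAt_id t).const_mul (-(σ k) ^ 2)).div_const 2
    have hexp_b (k : Fin m) (b : ℝ) : HasDerivAt
        (fun b => Real.exp (-(σ k) ^ 2 * t / 2 + σ k * b))
        (Real.exp (-(σ k) ^ 2 * t / 2 + σ k * b) * σ k) b := by
      refine HasDerivAt.exp (HasDerivAt.const_add _ ?_)
      simpa using (hasDerivAt_id b).const_mul (σ k)
    have htime := (HasDerivAt.fun_sum (u := Finset.univ) fun k _ =>
      ((hd k).mul_const (x k)).mul (hexp_t k)).deriv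
    have hspace (i : Fin n) := iteratedDeriv_two_eq
      (fun s => HasDerivAt.fun_sum (u := Finset.univ) fun k _ =>
        ((hd₁ k i s).mul_const (x k)).mul_const (Real.exp (-(σ k) ^ 2 * t / 2 + σ k * b)))
      (HasDerivAt.fun_sum fun k _ => ((hd₂ k i).mul_const (x k)).mul_const _)
    have hnoise := iteratedDeriv_two_eq
      (fun b => HasDerivAt.fun_sum (u := Finset.univ) fun k _ =>
        (hexp_b k b).const_mul (gaussianMass T (D k) t w * x k))
      (HasDerivAt.fun_sum fun k _ => ((hexp_b k b).mul_const (σ k)).const_mul _)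
    refine (congrArg₂ (· + ·) (congrArg₂ (· + ·) (congrArg (2 * ·) htime)
      (Finset.sum_congr rfl fun i _ => hspace i)) hnoise).trans ?_
    rw [Finset.sum_comm, Finset.mul_sum, ← Finset.sum_add_distrib, ← Finset.sum_add_distrib]
    refine Finset.sum_eq_zero fun k _ => ?_
    rw [← Finset.sum_mul, ← Finset.sum_mul]
    linear_combination x k * Real.exp (-(σ k) ^ 2 * t / 2 + σ k * b) * hsum k
end
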